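/- Let M be an algebraically closed field containing a field K, and let L be a field extension of K that is algebraic over K. Then L is separable over K if and only if the tensor product M ⊗_K L has no nonzero nilpotent elements (i.e., M ⊗_K L is a reduced ring). -/

import Mathlib

open TensorProduct

theorem isReduced_tensorProduct_of_isSeparable (K L M : Type*) [Field K] [Field L] [Field M]
    [Algebra K L] [Algebra K M] [Algebra.IsSeparable K L] : IsReduced (M ⊗[K] L) := by
  refine IsReduced.tensorProduct_of_flat_of_forall_fg fun B ⟨s, hs⟩ ↦ ?_
  let E := IntermediateField.adjoin K (s : Set L)
  have hBE : B ≤ E.toSubalgebra := hs ▸ IntermediateField.algebra_adjoin_le_adjoin K _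
  have : FiniteDimensional K E := IntermediateField.finiteDimensional_adjoin
    fun x _ ↦ Algebra.IsIntegral.isIntegral x
  have : Algebra.FormallyUnramified K E := .of_isSeparable K E
  have : IsReduced (M ⊗[K] E) := Algebra.FormallyUnramified.isReduced_of_field M (M ⊗[K] E)
  exact isReduced_of_injective
    (Algebra.TensorProduct.map (AlgHom.id M M) (Subalgebra.inclusion hBE))
    (Module.Flat.lTensor_preserves_injective_linearMap (M := M)
      (Subalgebra.inclusion hBE).toLinearMap (Subalgebra.inclusion_injective hBE))

theorem isSeparable_of_isReduced_tensorProduct (K L M : Type*) [Field K] [Field L] [Field M]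
    [Algebra K L] [Algebra K M] [PerfectField M] [Algebra.IsAlgebraic K L]
    [IsReduced (M ⊗[K] L)] : Algebra.IsSeparable K L := by
  refine ⟨fun x ↦ ?_⟩
  have hx : IsIntegral K x := Algebra.IsIntegral.isIntegral x
  let p := minpoly K x
  have : Fact (Irreducible p) := ⟨minpoly.irreducible hx⟩
  let f : AdjoinRoot p →ₐ[K] L := AdjoinRoot.liftAlgHom p (Algebra.ofId K L) x (minpoly.aeval K x)
  have : IsReduced (M ⊗[K] AdjoinRoot p) := isReduced_of_injective
    (Algebra.TensorProduct.map (AlgHom.id M M) f)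
    (Module.Flat.lTensor_preserves_injective_linearMap (M := M) f.toLinearMap f.injective)
  have hr : ((Algebra.TensorProduct.rid K M M).toRingEquiv : M ⊗[K] K →+* M).comp
      (Algebra.TensorProduct.includeRight : K →ₐ[K] M ⊗[K] K).toRingHom = algebraMap K M := by
    ext a
    simp [Algebra.algebraMap_eq_smul_one]
  let e := (AdjoinRoot.tensorAlgEquiv (R := K) (T := M) p _ rfl).toRingEquiv.trans
    (AdjoinRoot.mapRingEquiv (Algebra.TensorProduct.rid K M M).toRingEquiv _
      (p.map (algebraMap K M)) (by
        rw [Polynomial.map_map, hr]))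
  have : IsReduced (AdjoinRoot (p.map (algebraMap K M))) :=
    isReduced_of_injective e.symm e.symm.injective
  have hp0 : p.map (algebraMap K M) ≠ 0 := Polynomial.map_ne_zero (minpoly.ne_zero hx)
  rw [IsSeparable, ← Polynomial.separable_map (algebraMap K M),
    PerfectField.separable_iff_squarefree, ← isRadical_iff_squarefree_of_ne_zero hp0,
    isRadical_iff_span_singleton, Ideal.isRadical_iff_quotient_reduced]
  exact this

theorem separable_iff_tensor_reduced
    (K L M : Type*) [Field K] [Field L] [Field M]
    [Algebra K L] [Algebra K M]
    [IsAlgClosed M] [Algebra.IsAlgebraic K L] :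
    Algebra.IsSeparable K L ↔ IsReduced (M ⊗[K] L) :=
  ⟨fun _ ↦ isReduced_tensorProduct_of_isSeparable K L M,
    fun _ ↦ isSeparable_of_isReduced_tensorProduct K L M⟩
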